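/- arXiv:1906.07759 — 6 statements merged into one kernel-verified Lean document; each statement's English description precedes it below -/
import Mathlib

section
/- If 0 < λ < sup_{t>0} Λ^e(t), then the function t ↦ R^e_λ(t) on (0,∞) has exactly two critical points 0 < t^{e,+} < t^{e,-}; t^{e,+} is a local minimum point with (R^e_λ)''(t^{e,+}) > 0, and t^{e,-} is a local maximum point with (R^e_λ)''(t^{e,-}) < 0. Moreover, Λ^e(t^{e,+}) = Λ^e(t^{e,-}) = λ and (Λ^e)'(t^{e,+}) > 0, (Λ^e)'(t^{e,-}) < 0. -/
open Real Filter Topology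

noncomputable section

/-- The fibering function `Λ^e(t)` (with `a,b,c` playing the roles of
`‖u‖₁², ‖u‖_{L^q}^q, ‖u‖_{L^γ}^γ`). -/
def LamE (q α γ a b c : ℝ) (t : ℝ) : ℝ :=
  q / ((α - q) * b) * ((2 - α) / 2 * a * t ^ ((2 : ℝ) - q) - (γ - α) / γ * c * t ^ (γ - q))

/-- The fibering function `Λ^n(t)`. -/
def LamN (q α γ a b c : ℝ) (t : ℝ) : ℝ :=
  1 / ((α - q) * b) * ((2 - α) * a * t ^ ((2 : ℝ) - q) - (γ - α) * c * t ^ (γ - q))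

/-- The fibering function `R^e_λ(t)` (with `d` playing the role of `‖u‖_{L^α}^α`). -/
def ReF (q α γ a b c d lam : ℝ) (t : ℝ) : ℝ :=
  α / d * (a / 2 * t ^ ((2 : ℝ) - α) + lam * b / q * t ^ (q - α) - c / γ * t ^ (γ - α))

/-- The fibering function `R^n_λ(t)`. -/
def RnF (q α γ a b c d lam : ℝ) (t : ℝ) : ℝ :=
  1 / d * (a * t ^ ((2 : ℝ) - α) + lam * b * t ^ (q - α) - c * t ^ (γ - α))

/-- The point `t^e = (C_e·a/c)^{1/(γ-2)}`, `C_e = γ(2-α)(2-q)/(2(γ-α)(γ-q))`,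
the global maximum point of `Λ^e`. -/
def tEmax (q α γ a c : ℝ) : ℝ :=
  (γ * (2 - α) * (2 - q) / (2 * (γ - α) * (γ - q)) * a / c) ^ ((1 : ℝ) / (γ - 2))

/-- The derivative of `t ↦ A t ^ p - B t ^ r` on `(0, ∞)`, in factored form. -/
theorem hasDerivAt_rpow_sub_rpow (A B p r : ℝ) {t : ℝ} (ht : 0 < t) :
    HasDerivAt (fun t : ℝ => A * t ^ p - B * t ^ r)
      (t ^ (p - 1) * (A * p - B * r * t ^ (r - p))) t := by
  have h := ((hasDerivAt_rpow_const (p := p) (Or.inl ht.ne')).const_mul A).sub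
    ((hasDerivAt_rpow_const (p := r) (Or.inl ht.ne')).const_mul B)
  refine h.congr_deriv ?_
  have e : t ^ (r - 1) = t ^ (p - 1) * t ^ (r - p) := by
    rw [← rpow_add ht]; ring_nf
  rw [e]; ring

/-- A value `l > 0` strictly below some value of `t ↦ A t ^ p - B t ^ r`, `0 < p < r`, is attained
exactly twice on `(0, ∞)`: once with positive and once with negative derivative. -/
theorem exists_two_roots_rpow_sub_rpow {A B p r l s : ℝ} (hA : 0 < A) (hB : 0 < B) (hp : 0 < p)
    (hpr : p < r) (hl : 0 < l) (hs : 0 < s) (hls : l < A * s ^ p - B * s ^ r) :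
    ∃ x y : ℝ, 0 < x ∧ x < y ∧ A * x ^ p - B * x ^ r = l ∧ A * y ^ p - B * y ^ r = l ∧
      (∀ t > (0 : ℝ), A * t ^ p - B * t ^ r = l → t = x ∨ t = y) ∧
      0 < deriv (fun t : ℝ => A * t ^ p - B * t ^ r) x ∧
      deriv (fun t : ℝ => A * t ^ p - B * t ^ r) y < 0 := by
  have hr : 0 < r := hp.trans hpr
  have hrp : 0 < r - p := sub_pos.2 hpr
  set g : ℝ → ℝ := fun t => A * t ^ p - B * t ^ r with hg
  have hcont : Continuous g :=
    ((continuous_rpow_const hp.le).const_mul A).sub ((continuous_rpow_const hr.le).const_mul B)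
  have hg0 : g 0 = 0 := by simp [hg, zero_rpow hp.ne', zero_rpow hr.ne']
  set m : ℝ := (A * p / (B * r)) ^ (r - p)⁻¹ with hm
  have hm0 : 0 < m := by positivity
  have hmpow : B * r * m ^ (r - p) = A * p := by
    rw [hm, rpow_inv_rpow (by positivity) hrp.ne']
    field_simp
  have hpos : ∀ t, 0 < t → t < m → 0 < deriv g t := by
    intro t ht htm
    rw [(hasDerivAt_rpow_sub_rpow A B p r ht).deriv, ← hmpow, ← mul_sub]
    have := rpow_lt_rpow ht.le htm hrp
    exact mul_pos (rpow_pos_of_pos ht _) (mul_pos (mul_pos hB hr) (sub_pos.2 this))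
  have hneg : ∀ t, m < t → deriv g t < 0 := by
    intro t htm
    have ht := hm0.trans htm
    rw [(hasDerivAt_rpow_sub_rpow A B p r ht).deriv, ← hmpow, ← mul_sub]
    have := rpow_lt_rpow hm0.le htm hrp
    exact mul_neg_of_pos_of_neg (rpow_pos_of_pos ht _)
      (mul_neg_of_pos_of_neg (mul_pos hB hr) (sub_neg.2 this))
  have hmono : StrictMonoOn g (Set.Icc 0 m) := by
    refine strictMonoOn_of_deriv_pos (convex_Icc 0 m) hcont.continuousOn fun t ht => ?_
    rw [interior_Icc] at ht
    exact hpos t ht.1 ht.2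
  have hanti : StrictAntiOn g (Set.Ici m) := by
    refine strictAntiOn_of_deriv_neg (convex_Ici m) hcont.continuousOn fun t ht => ?_
    rw [interior_Ici] at ht
    exact hneg t ht
  have hlm : l < g m := by
    refine lt_of_lt_of_le hls ?_
    rcases le_total s m with h | h
    · exact hmono.monotoneOn ⟨hs.le, h⟩ ⟨hm0.le, le_rfl⟩ h
    · exact hanti.antitoneOn Set.self_mem_Ici h h
  set T : ℝ := (A / B) ^ (r - p)⁻¹ with hT
  have hT0 : 0 < T := by positivity
  have hgT : g T = 0 := by
    have e : T ^ r = T ^ p * (A / B) := by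
      rw [← rpow_inv_rpow (x := A / B) (by positivity) hrp.ne', ← hT, ← rpow_add hT0]
      ring_nf
    simp only [hg, e]
    field_simp
    ring
  have hmT : m ≤ T := by
    by_contra! h
    have := hmono ⟨le_rfl, hm0.le⟩ ⟨hT0.le, h.le⟩ hT0
    rw [hg0, hgT] at this
    exact lt_irrefl _ this
  obtain ⟨x, hx, hgx⟩ := intermediate_value_Ioo hm0.le hcont.continuousOn
    (show l ∈ Set.Ioo (g 0) (g m) from ⟨hg0.trans_lt hl, hlm⟩)
  obtain ⟨y, hy, hgy⟩ := intermediate_value_Ioo' hmT hcont.continuousOn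
    (show l ∈ Set.Ioo (g T) (g m) from ⟨hgT.trans_lt hl, hlm⟩)
  refine ⟨x, y, hx.1, hx.2.trans hy.1, hgx, hgy, fun t ht hgt => ?_, hpos x hx.1 hx.2,
    hneg y hy.1⟩
  rcases le_total t m with h | h
  · exact Or.inl (hmono.injOn ⟨ht.le, h⟩ ⟨hx.1.le, hx.2.le⟩ (hgt.trans hgx.symm))
  · exact Or.inr (hanti.injOn h hy.1.le (hgt.trans hgy.symm))

theorem LamE_eq_rpow_sub_rpow (q α γ a b c : ℝ) :
    LamE q α γ a b c = fun t : ℝ => q / ((α - q) * b) * ((2 - α) / 2 * a) * t ^ (2 - q) -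
      q / ((α - q) * b) * ((γ - α) / γ * c) * t ^ (γ - q) := by
  funext t
  rw [LamE]
  ring

/-- The derivative of `ReF` is a positive multiple of `LamE - lam`. -/
theorem deriv_ReF {q α γ a b c d lam t : ℝ} (hq : q ≠ 0) (hqα : q ≠ α) (hb : b ≠ 0)
    (ht : 0 < t) :
    deriv (ReF q α γ a b c d lam) t =
      α * (α - q) * b / (d * q) * t ^ (q - α - 1) * (LamE q α γ a b c t - lam) := by
  have hd (e : ℝ) : HasDerivAt (fun t : ℝ => t ^ e) (e * t ^ (e - 1)) t :=
    hasDerivAt_rpow_const (Or.inl ht.ne')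
  have h : HasDerivAt (ReF q α γ a b c d lam) _ t :=
    ((((hd (2 - α)).const_mul (a / 2)).add ((hd (q - α)).const_mul (lam * b / q))).sub
      ((hd (γ - α)).const_mul (c / γ))).const_mul (α / d)
  have e₁ : t ^ (2 - α - 1) = t ^ (q - α - 1) * t ^ (2 - q) := by
    rw [← rpow_add ht]; ring_nf
  have e₂ : t ^ (γ - α - 1) = t ^ (q - α - 1) * t ^ (γ - q) := by
    rw [← rpow_add ht]; ring_nf
  have hαq : α - q ≠ 0 := sub_ne_zero.2 hqα.symm
  rw [h.deriv, e₁, e₂, LamE]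
  field_simp
  ring

/-- At a point where `LamE = lam`, the second derivative of `ReF` is a positive multiple of the
derivative of `LamE`. -/
theorem deriv_deriv_ReF {q α γ a b c d lam t : ℝ} (hq : q ≠ 0) (hqα : q ≠ α) (hb : b ≠ 0)
    (ht : 0 < t) (hlam : LamE q α γ a b c t = lam) :
    deriv (deriv (ReF q α γ a b c d lam)) t =
      α * (α - q) * b / (d * q) * t ^ (q - α - 1) * deriv (LamE q α γ a b c) t := by
  have heq : deriv (ReF q α γ a b c d lam) =ᶠ[𝓝 t] fun t =>
      α * (α - q) * b / (d * q) * t ^ (q - α - 1) * (LamE q α γ a b c t - lam) := by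
    filter_upwards [lt_mem_nhds ht] with x hx using deriv_ReF hq hqα hb hx
  have hL : DifferentiableAt ℝ (LamE q α γ a b c) t := by
    rw [LamE_eq_rpow_sub_rpow]
    exact (hasDerivAt_rpow_sub_rpow _ _ _ _ ht).differentiableAt
  have h := ((hasDerivAt_rpow_const (p := q - α - 1) (Or.inl ht.ne')).const_mul
    (α * (α - q) * b / (d * q))).mul (hL.hasDerivAt.sub_const lam)
  rw [heq.deriv_eq]
  refine h.deriv.trans ?_
  rw [hlam, sub_self, mul_zero, zero_add]

theorem continuousAt_ReF {q α γ a b c d lam t : ℝ} (ht : 0 < t) :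
    ContinuousAt (ReF q α γ a b c d lam) t := by
  have h (e : ℝ) : ContinuousAt (fun t : ℝ => t ^ e) t :=
    continuousAt_rpow_const t e (Or.inl ht.ne')
  exact (((h _).const_mul _).add ((h _).const_mul _)).sub ((h _).const_mul _) |>.const_mul _

/-- for `0 < λ < sup_{t>0} Λ^e(t)`, the function `R^e_λ` has exactly two
critical points `0 < t^{e,+} < t^{e,-}` on `(0,∞)`; `t^{e,+}` is a local minimum with
`(R^e_λ)'' > 0` there, `t^{e,-}` a local maximum with `(R^e_λ)'' < 0` there; moreover
`Λ^e = λ` at both points and `(Λ^e)'(t^{e,+}) > 0`, `(Λ^e)'(t^{e,-}) < 0`. -/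
theorem ReF_two_critical_points (q α γ a b c d : ℝ)
    (hq : 1 < q) (hqα : q < α) (hα : α < 2) (hγ : 2 < γ)
    (ha : 0 < a) (hb : 0 < b) (hc : 0 < c) (hd : 0 < d)
    (lam : ℝ) (hlam0 : 0 < lam)
    (hlam : lam < sSup {y | ∃ t > (0 : ℝ), y = LamE q α γ a b c t}) :
    ∃ tp tm : ℝ, 0 < tp ∧ tp < tm ∧
      deriv (ReF q α γ a b c d lam) tp = 0 ∧
      deriv (ReF q α γ a b c d lam) tm = 0 ∧
      (∀ t > (0 : ℝ), deriv (ReF q α γ a b c d lam) t = 0 → t = tp ∨ t = tm) ∧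
      IsLocalMin (ReF q α γ a b c d lam) tp ∧
      0 < deriv (deriv (ReF q α γ a b c d lam)) tp ∧
      IsLocalMax (ReF q α γ a b c d lam) tm ∧
      deriv (deriv (ReF q α γ a b c d lam)) tm < 0 ∧
      LamE q α γ a b c tp = lam ∧ LamE q α γ a b c tm = lam ∧
      0 < deriv (LamE q α γ a b c) tp ∧ deriv (LamE q α γ a b c) tm < 0 := by
  have hq0 : 0 < q := one_pos.trans hq
  have hαq : 0 < α - q := sub_pos.2 hqα
  have h2α : 0 < 2 - α := sub_pos.2 hα
  have hγα : 0 < γ - α := sub_pos.2 (hα.trans hγ)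
  have hα0 : 0 < α := hq0.trans hqα
  have hγ0 : 0 < γ := two_pos.trans hγ
  obtain ⟨_, ⟨s, hs, rfl⟩, hls⟩ := exists_lt_of_lt_csSup
    (s := {y | ∃ t > (0 : ℝ), y = LamE q α γ a b c t}) ⟨_, 1, one_pos, rfl⟩ hlam
  have key := LamE_eq_rpow_sub_rpow q α γ a b c
  rw [key] at hls
  obtain ⟨x, y, hx, hxy, hgx, hgy, huniq, hdx, hdy⟩ := exists_two_roots_rpow_sub_rpow
    (by positivity) (by positivity) (by linarith) (by linarith) hlam0 hs hls
  rw [← key] at hdx hdy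
  simp only [← congrFun key] at hgx hgy huniq
  have hy := hx.trans hxy
  have hK {t : ℝ} (ht : 0 < t) : 0 < α * (α - q) * b / (d * q) * t ^ (q - α - 1) := by
    have := rpow_pos_of_pos ht (q - α - 1)
    positivity
  have hcrit {t : ℝ} (ht : 0 < t) :
      deriv (ReF q α γ a b c d lam) t = 0 ↔ LamE q α γ a b c t = lam := by
    rw [deriv_ReF hq0.ne' hqα.ne hb.ne' ht, mul_eq_zero_iff_left (hK ht).ne', sub_eq_zero]
  have hx2 : 0 < deriv (deriv (ReF q α γ a b c d lam)) x := by
    rw [deriv_deriv_ReF hq0.ne' hqα.ne hb.ne' hx hgx]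
    exact mul_pos (hK hx) hdx
  have hy2 : deriv (deriv (ReF q α γ a b c d lam)) y < 0 := by
    rw [deriv_deriv_ReF hq0.ne' hqα.ne hb.ne' hy hgy]
    exact mul_neg_of_pos_of_neg (hK hy) hdy
  have hx1 := (hcrit hx).2 hgx
  have hy1 := (hcrit hy).2 hgy
  exact ⟨x, y, hx, hxy, hx1, hy1, fun t ht h => huniq t ht ((hcrit ht).1 h),
    isLocalMin_of_deriv_deriv_pos hx2 hx1 (continuousAt_ReF hx), hx2,
    isLocalMax_of_deriv_deriv_neg hy2 hy1 (continuousAt_ReF hy), hy2, hgx, hgy, hdx, hdy⟩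

end
end

section
/- For t > 0 one has Λ^e(t) = Λ^n(t) if and only if (Λ^e)'(t) = 0, which holds if and only if t = t^e := (C_e·a/c)^{1/(γ−2)} with C_e = γ(2−α)(2−q)/(2(γ−α)(γ−q)); t^e is the unique critical point of Λ^e on (0,∞) and is its global maximum point. Moreover, Λ^e(t) < Λ^n(t) for all sufficiently small t > 0. -/
open Real Filter Topology

noncomputable section

/-- The factor that governs both the sign of `(Λ^e)'` and the sign of `Λ^n - Λ^e`. -/
def fiberingFactor (q α γ a c t : ℝ) : ℝ :=
  (2 - α) * (2 - q) / 2 * a - (γ - α) * (γ - q) / γ * c * t ^ (γ - 2)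

lemma hasDerivAt_LamE {q α γ a b c t : ℝ} (ht : 0 < t) :
    HasDerivAt (LamE q α γ a b c)
      (q / ((α - q) * b) * t ^ (1 - q) * fiberingFactor q α γ a c t) t := by
  have h1 := (Real.hasDerivAt_rpow_const (p := 2 - q) (Or.inl ht.ne')).const_mul
    ((2 - α) / 2 * a)
  have h2 := (Real.hasDerivAt_rpow_const (p := γ - q) (Or.inl ht.ne')).const_mul
    ((γ - α) / γ * c)
  refine ((h1.sub h2).const_mul (q / ((α - q) * b))).congr_deriv ?_
  have e1 : t ^ (2 - q - 1) = t ^ (1 - q) := by ring_nf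
  have e2 : t ^ (γ - q - 1) = t ^ (1 - q) * t ^ (γ - 2) := by
    rw [← Real.rpow_add ht]; ring_nf
  rw [e1, e2, fiberingFactor]
  ring

lemma LamN_sub_LamE {q α γ a b c t : ℝ} (hγ : γ ≠ 0) (ht : 0 < t) :
    LamN q α γ a b c t - LamE q α γ a b c t =
      1 / ((α - q) * b) * t ^ (2 - q) * fiberingFactor q α γ a c t := by
  have e : t ^ (γ - q) = t ^ (2 - q) * t ^ (γ - 2) := by
    rw [← Real.rpow_add ht]; ring_nf
  rw [LamN, LamE, e, fiberingFactor]
  field_simp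
  ring

lemma tEmax_pos {q α γ a c : ℝ} (hqα : q < α) (hα : α < 2) (hγ : 2 < γ)
    (ha : 0 < a) (hc : 0 < c) : 0 < tEmax q α γ a c := by
  have h1 : 0 < 2 - α := by linarith
  have h2 : 0 < 2 - q := by linarith
  have h3 : 0 < γ - α := by linarith
  have h4 : 0 < γ - q := by linarith
  have h5 : 0 < γ := by linarith
  unfold tEmax
  positivity

lemma fiberingFactor_eq {q α γ a c t : ℝ} (hqα : q < α) (hα : α < 2) (hγ : 2 < γ)
    (ha : 0 < a) (hc : 0 < c) :
    fiberingFactor q α γ a c t =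
      (γ - α) * (γ - q) / γ * c * (tEmax q α γ a c ^ (γ - 2) - t ^ (γ - 2)) := by
  have h1 : 0 < 2 - α := by linarith
  have h2 : 0 < 2 - q := by linarith
  have h3 : 0 < γ - α := by linarith
  have h4 : 0 < γ - q := by linarith
  have h5 : 0 < γ := by linarith
  have h6 : γ - 2 ≠ 0 := by linarith
  rw [tEmax, ← Real.rpow_mul (by positivity), one_div_mul_cancel h6, Real.rpow_one,
    fiberingFactor]
  field_simp

lemma fiberingFactor_pos_iff {q α γ a c t : ℝ} (hqα : q < α) (hα : α < 2) (hγ : 2 < γ)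
    (ha : 0 < a) (hc : 0 < c) (ht : 0 < t) :
    0 < fiberingFactor q α γ a c t ↔ t < tEmax q α γ a c := by
  have h3 : 0 < γ - α := by linarith
  have h4 : 0 < γ - q := by linarith
  have h5 : 0 < γ := by linarith
  rw [fiberingFactor_eq hqα hα hγ ha hc, mul_pos_iff_of_pos_left (by positivity), sub_pos,
    Real.rpow_lt_rpow_iff ht.le (tEmax_pos hqα hα hγ ha hc).le (by linarith)]

lemma fiberingFactor_neg_iff {q α γ a c t : ℝ} (hqα : q < α) (hα : α < 2) (hγ : 2 < γ)
    (ha : 0 < a) (hc : 0 < c) (ht : 0 < t) :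
    fiberingFactor q α γ a c t < 0 ↔ tEmax q α γ a c < t := by
  have h3 : 0 < γ - α := by linarith
  have h4 : 0 < γ - q := by linarith
  have h5 : 0 < γ := by linarith
  rw [fiberingFactor_eq hqα hα hγ ha hc, ← neg_pos, ← mul_neg,
    mul_pos_iff_of_pos_left (by positivity), neg_sub, sub_pos,
    Real.rpow_lt_rpow_iff (tEmax_pos hqα hα hγ ha hc).le ht.le (by linarith)]

lemma fiberingFactor_eq_zero_iff {q α γ a c t : ℝ} (hqα : q < α) (hα : α < 2) (hγ : 2 < γ)
    (ha : 0 < a) (hc : 0 < c) (ht : 0 < t) :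
    fiberingFactor q α γ a c t = 0 ↔ t = tEmax q α γ a c := by
  have h1 := fiberingFactor_pos_iff hqα hα hγ ha hc ht
  have h2 := fiberingFactor_neg_iff hqα hα hγ ha hc ht
  rw [← not_iff_not, ← ne_eq, ← ne_eq, ne_iff_lt_or_gt, ne_iff_lt_or_gt,
    h1, h2, or_comm]

/-- for `t > 0`, `Λ^e(t) = Λ^n(t)` iff `(Λ^e)'(t) = 0` iff `t = t^e`;
`t^e` is the unique critical point of `Λ^e` on `(0,∞)` and its global maximum point;
and `Λ^e(t) < Λ^n(t)` for all sufficiently small `t > 0`. -/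
theorem LamE_eq_LamN_iff_critical (q α γ a b c : ℝ)
    (hq : 1 < q) (hqα : q < α) (hα : α < 2) (hγ : 2 < γ)
    (ha : 0 < a) (hb : 0 < b) (hc : 0 < c) :
    (∀ t > (0 : ℝ),
      (LamE q α γ a b c t = LamN q α γ a b c t ↔ deriv (LamE q α γ a b c) t = 0) ∧
      (deriv (LamE q α γ a b c) t = 0 ↔ t = tEmax q α γ a c)) ∧
    (∀ t > (0 : ℝ), t ≠ tEmax q α γ a c →
      LamE q α γ a b c t < LamE q α γ a b c (tEmax q α γ a c)) ∧
    (∀ᶠ t in nhdsWithin (0 : ℝ) (Set.Ioi 0),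
      LamE q α γ a b c t < LamN q α γ a b c t) := by
  have hγ0 : γ ≠ 0 := by linarith
  have hD : 0 < (α - q) * b := mul_pos (by linarith) hb
  have hT := tEmax_pos hqα hα hγ ha hc
  have hd {t : ℝ} (ht : 0 < t) :=
    hasDerivAt_LamE (q := q) (α := α) (γ := γ) (a := a) (b := b) (c := c) ht
  have hcoef {t : ℝ} (ht : 0 < t) : 0 < q / ((α - q) * b) * t ^ (1 - q) := by
    have : 0 < q := by linarith
    positivity
  have hcoef' {t : ℝ} (ht : 0 < t) : 0 < 1 / ((α - q) * b) * t ^ (2 - q) := by positivity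
  have hdiff {t : ℝ} (ht : 0 < t) := LamN_sub_LamE (q := q) (α := α) (a := a) (b := b) (c := c)
    hγ0 ht
  refine ⟨fun t ht => ?_, fun t ht hne => ?_, ?_⟩
  · have h0 : deriv (LamE q α γ a b c) t = 0 ↔ fiberingFactor q α γ a c t = 0 := by
      rw [(hd ht).deriv, mul_eq_zero, or_iff_right (hcoef ht).ne']
    refine ⟨?_, h0.trans (fiberingFactor_eq_zero_iff hqα hα hγ ha hc ht)⟩
    rw [h0, eq_comm, ← sub_eq_zero, hdiff ht, mul_eq_zero, or_iff_right (hcoef' ht).ne']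
  · rcases hne.lt_or_gt with hlt | hgt
    · refine strictMonoOn_of_deriv_pos (convex_Icc t (tEmax q α γ a c))
        (fun x hx => (hd (ht.trans_le hx.1)).continuousAt.continuousWithinAt)
        (fun x hx => ?_) (Set.left_mem_Icc.2 hlt.le) (Set.right_mem_Icc.2 hlt.le) hlt
      rw [interior_Icc] at hx
      have hx0 := ht.trans hx.1
      rw [(hd hx0).deriv]
      exact mul_pos (hcoef hx0) ((fiberingFactor_pos_iff hqα hα hγ ha hc hx0).2 hx.2)
    · refine strictAntiOn_of_deriv_neg (convex_Icc (tEmax q α γ a c) t)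
        (fun x hx => (hd (hT.trans_le hx.1)).continuousAt.continuousWithinAt)
        (fun x hx => ?_) (Set.left_mem_Icc.2 hgt.le) (Set.right_mem_Icc.2 hgt.le) hgt
      rw [interior_Icc] at hx
      have hx0 := hT.trans hx.1
      rw [(hd hx0).deriv]
      exact mul_neg_of_pos_of_neg (hcoef hx0)
        ((fiberingFactor_neg_iff hqα hα hγ ha hc hx0).2 hx.1)
  · filter_upwards [Ioo_mem_nhdsGT hT] with t ht
    rw [← sub_pos, hdiff ht.1]
    exact mul_pos (hcoef' ht.1) ((fiberingFactor_pos_iff hqα hα hγ ha hc ht.1).2 ht.2)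

end
end

section
/- For any λ ∈ ℝ and t > 0 there holds the identity R^e_λ(t) − R^n_λ(t) = −((α−q)·b·t^{q−α}/(q·d))·(Λ^e(t) − λ); in particular R^e_λ(t) = R^n_λ(t) if and only if Λ^e(t) = λ, and consequently for each λ with 0 < λ < sup_{t>0} Λ^e(t), the equation R^e_λ(t) = R^n_λ(t) has precisely two solutions on (0,∞), namely t = t^{e,+}_λ and t = t^{e,-}_λ. -/
open Real Filter Topology

noncomputable section

/-- A strictly convex power agrees with an affine function at no more than two points. -/
theorem rpow_eq_affine_not_three {p m k x y z : ℝ} (hp : 1 < p) (hx : 0 ≤ x) (hxy : x < y)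
    (hyz : y < z) (ex : x ^ p = m * x + k) (ey : y ^ p = m * y + k) (ez : z ^ p = m * z + k) :
    False := by
  have h := (strictConvexOn_rpow hp).slope_strict_mono_adjacent (x := x) (y := y) (z := z)
    hx (Set.mem_Ici.2 (by linarith)) hxy hyz
  simp only [ex, ey, ez] at h
  have h1 : (m * y + k - (m * x + k)) / (y - x) = m := by
    rw [div_eq_iff (by linarith)]; ring
  have h2 : (m * z + k - (m * y + k)) / (z - y) = m := by
    rw [div_eq_iff (by linarith)]; ring
  rw [h1, h2] at h
  exact lt_irrefl _ h

theorem rpow_eq_of_LamE_eq {q α γ a b c lam t : ℝ} (hq : 1 < q) (hqα : q < α) (hα : α < 2)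
    (hγ : 2 < γ) (hb : 0 < b) (hc : 0 < c) (ht : 0 < t) (h : LamE q α γ a b c t = lam) :
    (t ^ (2 - q)) ^ ((γ - q) / (2 - q)) =
      ((2 - α) / 2 * a / ((γ - α) / γ * c)) * t ^ (2 - q)
        + -(lam * ((α - q) * b) / q / ((γ - α) / γ * c)) := by
  have h2q : 2 - q ≠ 0 := by linarith
  have hγα : γ - α ≠ 0 := by linarith
  have hαq : α - q ≠ 0 := by linarith
  have hγ0 : γ ≠ 0 := by linarith
  have hq0 : q ≠ 0 := by linarith
  rw [← Real.rpow_mul ht.le, mul_div_cancel₀ _ h2q, ← h, LamE]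
  field_simp
  ring

theorem LamE_not_three {q α γ a b c lam x y z : ℝ} (hq : 1 < q) (hqα : q < α) (hα : α < 2)
    (hγ : 2 < γ) (hb : 0 < b) (hc : 0 < c) (hx : 0 < x) (hxy : x < y) (hyz : y < z)
    (ex : LamE q α γ a b c x = lam) (ey : LamE q α γ a b c y = lam)
    (ez : LamE q α γ a b c z = lam) : False := by
  have h2q : 0 < 2 - q := by linarith
  have hy : 0 < y := hx.trans hxy
  exact rpow_eq_affine_not_three (p := (γ - q) / (2 - q))
    ((one_lt_div h2q).2 (by linarith)) (Real.rpow_nonneg hx.le _)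
    (Real.rpow_lt_rpow hx.le hxy h2q) (Real.rpow_lt_rpow hy.le hyz h2q)
    (rpow_eq_of_LamE_eq hq hqα hα hγ hb hc hx ex)
    (rpow_eq_of_LamE_eq hq hqα hα hγ hb hc hy ey)
    (rpow_eq_of_LamE_eq hq hqα hα hγ hb hc (hy.trans hyz) ez)

theorem ReF_sub_RnF_eq {q α γ a b c d t : ℝ} (lam : ℝ) (hq : 1 < q) (hqα : q < α)
    (hγ : 2 < γ) (hb : 0 < b) (hd : 0 < d) (ht : 0 < t) :
    ReF q α γ a b c d lam t - RnF q α γ a b c d lam t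
      = -((α - q) * b * t ^ (q - α) / (q * d)) * (LamE q α γ a b c t - lam) := by
  have hαq : α - q ≠ 0 := by linarith
  have hγ0 : γ ≠ 0 := by linarith
  have hq0 : q ≠ 0 := by linarith
  have e1 : t ^ (2 - α) = t ^ (q - α) * t ^ (2 - q) := by
    rw [← Real.rpow_add ht]; congr 1; ring
  have e2 : t ^ (γ - α) = t ^ (q - α) * t ^ (γ - q) := by
    rw [← Real.rpow_add ht]; congr 1; ring
  rw [ReF, RnF, LamE, e1, e2]
  field_simp
  ring

theorem hasDerivAt_ReF {q α γ a b c d t : ℝ} (lam : ℝ) (hq : 1 < q) (hqα : q < α)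
    (hγ : 2 < γ) (hb : 0 < b) (ht : 0 < t) :
    HasDerivAt (ReF q α γ a b c d lam)
      (α / d * ((α - q) * b / q) * t ^ (q - α - 1) * (LamE q α γ a b c t - lam)) t := by
  have hαq : α - q ≠ 0 := by linarith
  have hγ0 : γ ≠ 0 := by linarith
  have hq0 : q ≠ 0 := by linarith
  have hp (p : ℝ) : HasDerivAt (fun s : ℝ => s ^ p) (p * t ^ (p - 1)) t :=
    Real.hasDerivAt_rpow_const (Or.inl ht.ne')
  have h := ((((hp (2 - α)).const_mul (a / 2)).add ((hp (q - α)).const_mul (lam * b / q))).sub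
    ((hp (γ - α)).const_mul (c / γ))).const_mul (α / d)
  have e1 : t ^ (2 - α - 1) = t ^ (q - α - 1) * t ^ (2 - q) := by
    rw [← Real.rpow_add ht]; congr 1; ring
  have e2 : t ^ (γ - α - 1) = t ^ (q - α - 1) * t ^ (γ - q) := by
    rw [← Real.rpow_add ht]; congr 1; ring
  refine h.congr_deriv ?_
  rw [LamE, e1, e2]
  field_simp
  ring

theorem ReF_eq_RnF_iff {q α γ a b c d t : ℝ} (lam : ℝ) (hq : 1 < q) (hqα : q < α)
    (hγ : 2 < γ) (hb : 0 < b) (hd : 0 < d) (ht : 0 < t) :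
    ReF q α γ a b c d lam t = RnF q α γ a b c d lam t ↔ LamE q α γ a b c t = lam := by
  have hαq : 0 < α - q := by linarith
  have hq0 : 0 < q := by linarith
  have hk : -((α - q) * b * t ^ (q - α) / (q * d)) ≠ 0 := neg_ne_zero.2 (by positivity)
  rw [← sub_eq_zero, ReF_sub_RnF_eq lam hq hqα hγ hb hd ht, mul_eq_zero, sub_eq_zero]
  simp only [hk, false_or]

theorem LamE_eq_of_deriv_ReF_eq_zero {q α γ a b c d lam t : ℝ} (hq : 1 < q) (hqα : q < α)
    (hγ : 2 < γ) (hb : 0 < b) (hd : 0 < d) (ht : 0 < t)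
    (h : deriv (ReF q α γ a b c d lam) t = 0) : LamE q α γ a b c t = lam := by
  have hαq : 0 < α - q := by linarith
  have hq0 : 0 < q := by linarith
  have hα0 : 0 < α := by linarith
  have hk : α / d * ((α - q) * b / q) * t ^ (q - α - 1) ≠ 0 := by positivity
  rw [(hasDerivAt_ReF lam hq hqα hγ hb ht).deriv] at h
  exact sub_eq_zero.1 ((mul_eq_zero.1 h).resolve_left hk)

/-- the identity
`R^e_λ(t) − R^n_λ(t) = −((α−q)·b·t^{q−α}/(q·d))·(Λ^e(t) − λ)` for `t > 0`; hence
`R^e_λ(t) = R^n_λ(t)` iff `Λ^e(t) = λ`, and for `0 < λ < sup Λ^e` the equation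
`R^e_λ(t) = R^n_λ(t)` has precisely the two solutions `t^{e,+}_λ`, `t^{e,-}_λ`. -/
theorem ReF_sub_RnF_identity (q α γ a b c d : ℝ)
    (hq : 1 < q) (hqα : q < α) (hα : α < 2) (hγ : 2 < γ)
    (ha : 0 < a) (hb : 0 < b) (hc : 0 < c) (hd : 0 < d) :
    (∀ lam : ℝ, ∀ t > (0 : ℝ),
      (ReF q α γ a b c d lam t - RnF q α γ a b c d lam t
        = -((α - q) * b * t ^ (q - α) / (q * d)) * (LamE q α γ a b c t - lam)) ∧
      (ReF q α γ a b c d lam t = RnF q α γ a b c d lam t ↔ LamE q α γ a b c t = lam)) ∧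
    (∀ lam : ℝ, 0 < lam →
      lam < sSup {y | ∃ t > (0 : ℝ), y = LamE q α γ a b c t} →
      ∀ tep tem : ℝ, 0 < tep → tep < tem →
        deriv (ReF q α γ a b c d lam) tep = 0 →
        deriv (ReF q α γ a b c d lam) tem = 0 →
        ∀ t > (0 : ℝ),
          (ReF q α γ a b c d lam t = RnF q α γ a b c d lam t ↔ t = tep ∨ t = tem)) := by
  refine ⟨fun lam t ht => ⟨ReF_sub_RnF_eq lam hq hqα hγ hb hd ht,
    ReF_eq_RnF_iff lam hq hqα hγ hb hd ht⟩, ?_⟩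
  intro lam _ _ x y hx hxy dx dy t ht
  have ex := LamE_eq_of_deriv_ReF_eq_zero hq hqα hγ hb hd hx dx
  have ey := LamE_eq_of_deriv_ReF_eq_zero hq hqα hγ hb hd (hx.trans hxy) dy
  rw [ReF_eq_RnF_iff lam hq hqα hγ hb hd ht]
  refine ⟨fun et => ?_, by rintro (rfl | rfl) <;> assumption⟩
  by_contra! hne
  rcases lt_or_gt_of_ne hne.1 with h | h
  · exact LamE_not_three hq hqα hα hγ hb hc ht h hxy et ex ey
  rcases lt_or_gt_of_ne hne.2 with h' | h'
  · exact LamE_not_three hq hqα hα hγ hb hc hx h h' ex et ey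
  · exact LamE_not_three hq hqα hα hγ hb hc hx hxy h' ex ey et

end
end

section
/- Assume 1 < q < α < 2 and 1 + α < γ, and let λ with 0 < λ < sup_{t>0} Λ^n(t), so that R^n_λ has exactly two critical points t^{n,+}_λ < t^{n,-}_λ. Then there exists exactly one point r ∈ (t^{n,+}_λ, t^{n,-}_λ) such that (R^n_λ)''(t) > 0 for t ∈ (0, r), (R^n_λ)''(r) = 0, and (R^n_λ)''(t) < 0 for t ∈ (r, +∞). -/
open Real Filter Topology

noncomputable section

theorem deriv_RnF (q α γ a b c d lam : ℝ) {t : ℝ} (ht : 0 < t) :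
    deriv (RnF q α γ a b c d lam) t =
      1 / d * (a * ((2 - α) * t ^ (2 - α - 1)) + lam * b * ((q - α) * t ^ (q - α - 1)) -
        c * ((γ - α) * t ^ (γ - α - 1))) := by
  have h (p : ℝ) : HasDerivAt (fun x : ℝ => x ^ p) (p * t ^ (p - 1)) t :=
    hasDerivAt_rpow_const (Or.inl ht.ne')
  exact (((((h (2 - α)).const_mul a).add ((h (q - α)).const_mul (lam * b))).sub
    ((h (γ - α)).const_mul c)).const_mul (1 / d)).deriv

theorem hasDerivAt_deriv_RnF (q α γ a b c d lam : ℝ) {t : ℝ} (ht : 0 < t) :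
    HasDerivAt (deriv (RnF q α γ a b c d lam))
      (1 / d * t ^ (q - α - 2) * (lam * b * (α - q) * (α + 1 - q) -
        a * (2 - α) * (α - 1) * t ^ (2 - q) -
        c * (γ - α) * (γ - α - 1) * t ^ (γ - q))) t := by
  have h (p : ℝ) : HasDerivAt (fun x : ℝ => x ^ p) (p * t ^ (p - 1)) t :=
    hasDerivAt_rpow_const (Or.inl ht.ne')
  have key := (((((h (2 - α - 1)).const_mul (2 - α)).const_mul a).add
    (((h (q - α - 1)).const_mul (q - α)).const_mul (lam * b))).sub
    (((h (γ - α - 1)).const_mul (γ - α)).const_mul c)).const_mul (1 / d)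
  have e₁ : t ^ (2 - α - 1 - 1) = t ^ (q - α - 2) * t ^ (2 - q) := by
    rw [← rpow_add ht]; ring_nf
  have e₂ : t ^ (γ - α - 1 - 1) = t ^ (q - α - 2) * t ^ (γ - q) := by
    rw [← rpow_add ht]; ring_nf
  have e₃ : t ^ (q - α - 1 - 1) = t ^ (q - α - 2) := by ring_nf
  rw [e₁, e₂, e₃] at key
  refine (key.congr_deriv (by ring)).congr_of_eventuallyEq ?_
  filter_upwards [lt_mem_nhds ht] with x hx using deriv_RnF q α γ a b c d lam hx

theorem strictAntiOn_sub_rpow_sub_rpow {A C p s : ℝ} (B : ℝ) (hA : 0 < A) (hC : 0 < C)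
    (hp : 0 < p) (hs : 0 < s) :
    StrictAntiOn (fun t : ℝ => B - A * t ^ p - C * t ^ s) (Set.Ioi 0) := by
  intro x hx y _ hxy
  have h₁ := mul_lt_mul_of_pos_left (rpow_lt_rpow (le_of_lt hx) hxy hp) hA
  have h₂ := mul_lt_mul_of_pos_left (rpow_lt_rpow (le_of_lt hx) hxy hs) hC
  dsimp only
  linarith

/-- for `1 < q < α < 2`, `1 + α < γ` and `0 < λ < sup Λ^n`, there is
exactly one `r ∈ (t^{n,+}, t^{n,-})` with `(R^n_λ)'' > 0` on `(0, r)`, `(R^n_λ)''(r) = 0`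
and `(R^n_λ)'' < 0` on `(r, ∞)`. -/
theorem RnF_second_deriv_sign_change (q α γ a b c d : ℝ)
    (hq : 1 < q) (hqα : q < α) (hα : α < 2) (hγ2 : 2 < γ) (hγ : 1 + α < γ)
    (ha : 0 < a) (hb : 0 < b) (hc : 0 < c) (hd : 0 < d)
    (lam : ℝ) (hlam0 : 0 < lam)
    (hlam : lam < sSup {y | ∃ t > (0 : ℝ), y = LamN q α γ a b c t}) :
    ∀ tnp tnm : ℝ, 0 < tnp → tnp < tnm →
      deriv (RnF q α γ a b c d lam) tnp = 0 → deriv (RnF q α γ a b c d lam) tnm = 0 →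
      IsLocalMin (RnF q α γ a b c d lam) tnp → IsLocalMax (RnF q α γ a b c d lam) tnm →
      ∃ r : ℝ, tnp < r ∧ r < tnm ∧
        (∀ t : ℝ, 0 < t → t < r → 0 < deriv (deriv (RnF q α γ a b c d lam)) t) ∧
        deriv (deriv (RnF q α γ a b c d lam)) r = 0 ∧
        (∀ t : ℝ, r < t → deriv (deriv (RnF q α γ a b c d lam)) t < 0) ∧
        (∀ r' : ℝ, tnp < r' → r' < tnm →
          deriv (deriv (RnF q α γ a b c d lam)) r' = 0 → r' = r) := by
  intro tnp tnm htnp hlt hp hm _ _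
  obtain ⟨r, ⟨hr₁, hr₂⟩, hr⟩ := exists_deriv_eq_zero (f := deriv (RnF q α γ a b c d lam)) hlt
    (fun x hx => (hasDerivAt_deriv_RnF q α γ a b c d lam
      (htnp.trans_le hx.1)).continuousAt.continuousWithinAt) (hp.trans hm.symm)
  have hr₀ : 0 < r := htnp.trans hr₁
  have hanti := strictAntiOn_sub_rpow_sub_rpow (lam * b * (α - q) * (α + 1 - q))
    (mul_pos (mul_pos ha (sub_pos.2 hα)) (by linarith : 0 < α - 1))
    (mul_pos (mul_pos hc (by linarith : 0 < γ - α)) (by linarith : 0 < γ - α - 1))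
    (by linarith : 0 < 2 - q) (by linarith : 0 < γ - q)
  have hpos {t : ℝ} (ht : 0 < t) : 0 < 1 / d * t ^ (q - α - 2) := by positivity
  have hzero := hr
  rw [(hasDerivAt_deriv_RnF q α γ a b c d lam hr₀).deriv,
    mul_eq_zero_iff_left (hpos hr₀).ne'] at hzero
  have hleft (t : ℝ) (ht : 0 < t) (htr : t < r) :
      0 < deriv (deriv (RnF q α γ a b c d lam)) t := by
    rw [(hasDerivAt_deriv_RnF q α γ a b c d lam ht).deriv]
    exact mul_pos (hpos ht) (hzero.symm.trans_lt (hanti ht hr₀ htr))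
  have hright (t : ℝ) (htr : r < t) : deriv (deriv (RnF q α γ a b c d lam)) t < 0 := by
    have ht := hr₀.trans htr
    rw [(hasDerivAt_deriv_RnF q α γ a b c d lam ht).deriv]
    exact mul_neg_of_pos_of_neg (hpos ht) ((hanti hr₀ ht htr).trans_eq hzero)
  refine ⟨r, hr₁, hr₂, hleft, hr, hright, fun r' hr' _ h => ?_⟩
  rcases lt_trichotomy r' r with hlt' | heq | hgt
  · exact absurd h (hleft r' (htnp.trans hr') hlt').ne'
  · exact heq
  · exact absurd h (hright r' hgt).ne

end
end

section
/- Let 0 < λ < sup_{t>0} Λ^n(t), so that R^n_λ has exactly two critical points t^{n,+}_λ < t^{n,-}_λ, and let μ satisfy R^n_λ(t^{n,+}_λ) < μ < R^n_λ(t^{n,-}_λ). Then the equation R^n_λ(t) = μ has exactly three solutions s⁰ < s¹ < s² in (0,∞), which satisfy 0 < s⁰ < t^{n,+}_λ < s¹ < t^{n,-}_λ < s² < ∞ and (R^n_λ)'(s⁰) < 0, (R^n_λ)'(s¹) > 0, (R^n_λ)'(s²) < 0. -/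
open Real Filter Topology

noncomputable section

/-- On a convex set whose interior contains no critical point of `f`, a level strictly between a
larger value on the left and a smaller value on the right is attained exactly once, with negative
derivative. -/
theorem exists_unique_eq_of_deriv_ne_zero {f : ℝ → ℝ} {s : Set ℝ} (hs : Convex ℝ s)
    (hf : ContinuousOn f s) (hd : ∀ x ∈ interior s, deriv f x ≠ 0)
    {x y mu : ℝ} (hx : x ∈ s) (hy : y ∈ s) (hxy : x < y) (hmx : mu < f x) (hym : f y < mu) :
    ∃ z, x < z ∧ z < y ∧ f z = mu ∧ deriv f z < 0 ∧ ∀ t ∈ s, f t = mu → t = z := by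
  have hsub : Set.Icc x y ⊆ s := hs.ordConnected.out hx hy
  have hint : Set.Ioo x y ⊆ interior s :=
    interior_maximal (Set.Ioo_subset_Icc_self.trans hsub) isOpen_Ioo
  have hdiff : ∀ t ∈ interior s, DifferentiableAt ℝ f t := fun t ht =>
    differentiableAt_of_deriv_ne_zero (hd t ht)
  obtain ⟨w, hw, hweq⟩ := exists_deriv_eq_slope f hxy (hf.mono hsub)
    fun t ht => (hdiff t (hint ht)).differentiableWithinAt
  have hwneg : deriv f w < 0 := by
    rw [hweq]
    exact div_neg_of_neg_of_pos (by linarith) (by linarith)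
  have hneg : ∀ t ∈ interior s, deriv f t < 0 := by
    rcases hasDerivWithinAt_forall_lt_or_forall_gt_of_forall_ne hs.interior
      (fun t ht => (hdiff t ht).hasDerivAt.hasDerivWithinAt) hd with h | h
    · exact h
    · exact absurd (h w (hint hw)) hwneg.not_gt
  have hanti : StrictAntiOn f s := strictAntiOn_of_deriv_neg hs hf hneg
  obtain ⟨z, hz, hzmu⟩ := intermediate_value_Ioo' hxy.le (hf.mono hsub) ⟨hym, hmx⟩
  have hzs : z ∈ s := interior_subset (hint hz)
  exact ⟨z, hz.1, hz.2, hzmu, hneg z (hint hz),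
    fun t ht htmu => hanti.injOn ht hzs (htmu.trans hzmu.symm)⟩

theorem continuousOn_RnF (q α γ a b c d lam : ℝ) :
    ContinuousOn (RnF q α γ a b c d lam) (Set.Ioi 0) := by
  have h (r : ℝ) : ContinuousOn (fun t : ℝ => t ^ r) (Set.Ioi 0) :=
    continuousOn_id.rpow_const fun t ht => Or.inl (ne_of_gt ht)
  unfold RnF
  exact continuousOn_const.mul (((continuousOn_const.mul (h _)).add
    (continuousOn_const.mul (h _))).sub (continuousOn_const.mul (h _)))

theorem tendsto_RnF_nhdsGT_zero {q α γ a b c d lam : ℝ} (hqα : q < α) (hα : α < 2) (hγ : 2 < γ)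
    (hb : 0 < b) (hd : 0 < d) (hlam : 0 < lam) :
    Tendsto (RnF q α γ a b c d lam) (𝓝[>] 0) atTop := by
  have h0 {r : ℝ} (hr : 0 < r) : Tendsto (fun t : ℝ => t ^ r) (𝓝[>] 0) (𝓝 0) := by
    have h := (Real.continuousAt_rpow_const (0 : ℝ) r (Or.inr hr.le)).tendsto
    rw [Real.zero_rpow hr.ne'] at h
    exact h.mono_left nhdsWithin_le_nhds
  have h1 : Tendsto (fun t : ℝ => t ^ (q - α)) (𝓝[>] 0) atTop :=
    tendsto_rpow_neg_nhdsGT_zero (by linarith)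
  unfold RnF
  refine Tendsto.const_mul_atTop (by positivity) ?_
  have h2 := ((h0 (r := 2 - α) (by linarith)).const_mul a).add_atTop
    (h1.const_mul_atTop (mul_pos hlam hb))
  have h3 := h2.atTop_add ((h0 (r := γ - α) (by linarith)).const_mul c).neg
  simpa only [sub_eq_add_neg] using h3

theorem tendsto_RnF_atTop {q α γ a b c d lam : ℝ} (hqα : q < α) (hα : α < 2) (hγ : 2 < γ)
    (hc : 0 < c) (hd : 0 < d) :
    Tendsto (RnF q α γ a b c d lam) atTop atBot := by
  have h1 : Tendsto (fun t : ℝ => t ^ (2 - α)) atTop atTop := tendsto_rpow_atTop (by linarith)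
  have h2 : Tendsto (fun t : ℝ => t ^ (γ - 2)) atTop atTop := tendsto_rpow_atTop (by linarith)
  have h3 : Tendsto (fun t : ℝ => t ^ (q - α)) atTop (𝓝 0) := by
    simpa using tendsto_rpow_neg_atTop (y := α - q) (by linarith)
  have h4 : Tendsto (fun t : ℝ => a + -c * t ^ (γ - 2)) atTop atBot :=
    tendsto_const_nhds.add_atBot (h2.const_mul_atTop_of_neg (neg_lt_zero.mpr hc))
  have h5 := (h1.atTop_mul_atBot₀ h4).atBot_add (h3.const_mul (lam * b))
  unfold RnF
  refine Tendsto.const_mul_atBot (by positivity) (h5.congr' ?_)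
  filter_upwards [eventually_gt_atTop 0] with t ht
  have h : t ^ (γ - α) = t ^ (2 - α) * t ^ (γ - 2) := by
    rw [← Real.rpow_add ht]
    ring_nf
  rw [h]
  ring

/-- for `0 < λ < sup Λ^n` and `R^n_λ(t^{n,+}) < μ < R^n_λ(t^{n,-})`, the
equation `R^n_λ(t) = μ` has exactly three solutions `s⁰ < s¹ < s²`, with
`0 < s⁰ < t^{n,+} < s¹ < t^{n,-} < s²` and `(R^n_λ)'(s⁰) < 0`, `(R^n_λ)'(s¹) > 0`,
`(R^n_λ)'(s²) < 0`. -/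
theorem RnF_eq_mu_three_solutions (q α γ a b c d : ℝ)
    (hq : 1 < q) (hqα : q < α) (hα : α < 2) (hγ : 2 < γ)
    (ha : 0 < a) (hb : 0 < b) (hc : 0 < c) (hd : 0 < d)
    (lam : ℝ) (hlam0 : 0 < lam)
    (hlam : lam < sSup {y | ∃ t > (0 : ℝ), y = LamN q α γ a b c t}) :
    ∀ tnp tnm : ℝ, 0 < tnp → tnp < tnm →
      deriv (RnF q α γ a b c d lam) tnp = 0 → deriv (RnF q α γ a b c d lam) tnm = 0 →
      (∀ t > (0 : ℝ), deriv (RnF q α γ a b c d lam) t = 0 → t = tnp ∨ t = tnm) →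
      IsLocalMin (RnF q α γ a b c d lam) tnp → IsLocalMax (RnF q α γ a b c d lam) tnm →
      ∀ mu : ℝ, RnF q α γ a b c d lam tnp < mu → mu < RnF q α γ a b c d lam tnm →
        ∃ s0 s1 s2 : ℝ, 0 < s0 ∧ s0 < tnp ∧ tnp < s1 ∧ s1 < tnm ∧ tnm < s2 ∧
          RnF q α γ a b c d lam s0 = mu ∧ RnF q α γ a b c d lam s1 = mu ∧
          RnF q α γ a b c d lam s2 = mu ∧
          (∀ t : ℝ, 0 < t → RnF q α γ a b c d lam t = mu →
            t = s0 ∨ t = s1 ∨ t = s2) ∧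
          deriv (RnF q α γ a b c d lam) s0 < 0 ∧
          0 < deriv (RnF q α γ a b c d lam) s1 ∧
          deriv (RnF q α γ a b c d lam) s2 < 0 := by
  intro p m hp hpm _ _ hcrit _ _ mu hpmu hmum
  have hcont := continuousOn_RnF q α γ a b c d lam
  have hlim0 : Tendsto (RnF q α γ a b c d lam) (𝓝[>] 0) atTop :=
    tendsto_RnF_nhdsGT_zero hqα hα hγ hb hd hlam0
  have hlim : Tendsto (RnF q α γ a b c d lam) atTop atBot := tendsto_RnF_atTop hqα hα hγ hc hd
  generalize RnF q α γ a b c d lam = f at *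
  obtain ⟨x, hmux, hx0, hxp⟩ :=
    ((hlim0.eventually_gt_atTop mu).and (Ioo_mem_nhdsGT hp)).exists
  obtain ⟨y, hymu, hmy⟩ := ((hlim.eventually_lt_atBot mu).and (eventually_gt_atTop m)).exists
  obtain ⟨s0, h0, hs0p, hs0, hd0, hu0⟩ := exists_unique_eq_of_deriv_ne_zero
    (convex_Ioc 0 p) (hcont.mono fun t ht => ht.1)
    (fun t ht hdt => by
      rw [interior_Ioc] at ht
      rcases hcrit t ht.1 hdt with h | h <;> linarith [ht.2])
    ⟨hx0, hxp.le⟩ ⟨hp, le_rfl⟩ hxp hmux hpmu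
  obtain ⟨s1, hps1, hs1m, hs1, hd1, hu1⟩ := exists_unique_eq_of_deriv_ne_zero (f := -f) (mu := -mu)
    (convex_Icc p m) (hcont.mono fun t ht => hp.trans_le ht.1).neg
    (fun t ht hdt => by
      rw [interior_Icc] at ht
      rw [deriv.neg, neg_eq_zero] at hdt
      rcases hcrit t (hp.trans ht.1) hdt with h | h <;> linarith [ht.1, ht.2])
    ⟨le_rfl, hpm.le⟩ ⟨hpm.le, le_rfl⟩ hpm (neg_lt_neg hpmu) (neg_lt_neg hmum)
  obtain ⟨s2, hms2, -, hs2, hd2, hu2⟩ := exists_unique_eq_of_deriv_ne_zero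
    (convex_Ici m) (hcont.mono fun t ht => (hp.trans hpm).trans_le ht)
    (fun t ht hdt => by
      rw [interior_Ici, Set.mem_Ioi] at ht
      rcases hcrit t (by linarith) hdt with h | h <;> linarith)
    Set.self_mem_Ici (Set.mem_Ici.mpr hmy.le) hmy hmum hymu
  rw [deriv.neg, neg_lt_zero] at hd1
  refine ⟨s0, s1, s2, hx0.trans h0, hs0p, hps1, hs1m, hms2, hs0, neg_injective hs1, hs2,
    fun t ht htmu => ?_, hd0, hd1, hd2⟩
  rcases le_total t p with htp | htp
  · exact Or.inl (hu0 t ⟨ht, htp⟩ htmu)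
  rcases le_total t m with htm | htm
  · exact Or.inr (Or.inl (hu1 t ⟨htp, htm⟩ (congrArg Neg.neg htmu)))
  · exact Or.inr (Or.inr (hu2 t htm htmu))


end
end

section
/- For all a, b, c > 0 the functions Λ^e and Λ^n attain finite positive global maxima on (0,∞), and sup_{t>0} Λ^n(t) = κ · sup_{t>0} Λ^e(t), where κ = 2^{(γ−q)/(γ−2)}/(q·γ^{(2−q)/(γ−2)}); moreover κ > 1, so that sup_{t>0} Λ^e(t) < sup_{t>0} Λ^n(t). -/
open Real Filter Topology

noncomputable section

/-- For `0 < p < r`, the two-power function `t ↦ A t ^ p - B t ^ r` attains a positive global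
maximum on `(0, ∞)`. -/
theorem exists_pos_forall_rpow_sub_rpow_le {A B p r : ℝ} (hA : 0 < A) (hB : 0 < B) (hp : 0 < p)
    (hpr : p < r) :
    ∃ s > (0 : ℝ), (∀ t > (0 : ℝ), A * t ^ p - B * t ^ r ≤ A * s ^ p - B * s ^ r) ∧
      0 < A * s ^ p - B * s ^ r := by
  have hr : 0 < r := hp.trans hpr
  obtain ⟨s, hs, hcrit⟩ : ∃ s > (0 : ℝ), B * s ^ r = p / r * (A * s ^ p) := by
    have hC : 0 < p * A / (r * B) := by positivity
    refine ⟨(p * A / (r * B)) ^ (r - p)⁻¹, by positivity, ?_⟩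
    have h := rpow_inv_rpow hC.le (sub_pos.2 hpr).ne'
    generalize hs : (p * A / (r * B)) ^ (r - p)⁻¹ = s at h ⊢
    have hs0 : 0 < s := hs ▸ by positivity
    rw [← add_sub_cancel p r, rpow_add hs0, h, add_sub_cancel]
    field_simp
  have hval : A * s ^ p - B * s ^ r = A * s ^ p * (1 - p / r) := by rw [hcrit]; ring
  have hlt : p / r < 1 := (div_lt_one hr).2 hpr
  refine ⟨s, hs, fun t ht ↦ ?_, ?_⟩
  · obtain ⟨x, hx, rfl⟩ : ∃ x > (0 : ℝ), t = s * x := ⟨t / s, by positivity, by field_simp⟩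
    have key := rpow_one_add_le_one_add_mul_self (s := x ^ r - 1)
      (by linarith [rpow_pos_of_pos hx r]) (div_pos hp hr).le hlt.le
    rw [add_sub_cancel, ← rpow_mul hx.le, mul_div_cancel₀ _ hr.ne'] at key
    calc A * (s * x) ^ p - B * (s * x) ^ r
        = A * s ^ p * (x ^ p - p / r * x ^ r) := by
          rw [mul_rpow hs.le hx.le, mul_rpow hs.le hx.le, ← mul_assoc B, hcrit]; ring
      _ ≤ A * s ^ p * (1 - p / r) :=
          mul_le_mul_of_nonneg_left (by linarith) (by positivity)
      _ = _ := hval.symm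
  · rw [hval]
    have := sub_pos.2 hlt
    positivity

theorem exists_pos_forall_LamE_le {q α γ a b c : ℝ} (hq : 1 < q) (hqα : q < α) (hα : α < 2)
    (hγ : 2 < γ) (ha : 0 < a) (hb : 0 < b) (hc : 0 < c) :
    ∃ s > (0 : ℝ), (∀ t > (0 : ℝ), LamE q α γ a b c t ≤ LamE q α γ a b c s) ∧
      0 < LamE q α γ a b c s := by
  have h1 : 0 < 2 - α := by linarith
  have h2 : 0 < γ - α := by linarith
  have h3 : 0 < α - q := by linarith
  obtain ⟨s, hs, hmax, hpos⟩ := exists_pos_forall_rpow_sub_rpow_le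
    (A := (2 - α) / 2 * a) (B := (γ - α) / γ * c) (p := 2 - q) (r := γ - q)
    (by positivity) (by positivity) (by linarith) (by linarith)
  refine ⟨s, hs, fun t ht ↦ ?_, ?_⟩
  · exact mul_le_mul_of_nonneg_left (hmax t ht) (by positivity)
  · exact mul_pos (by positivity) hpos

/-- Rescaling the variable by `(2 / γ) ^ (1 / (γ - 2))` turns `Λ^n` into a multiple of `Λ^e`. -/
theorem LamN_rescale {q α γ a b c t : ℝ} (hq : 0 < q) (hγ : 2 < γ) (ht : 0 < t) :
    LamN q α γ a b c ((2 / γ) ^ (γ - 2)⁻¹ * t) =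
      (2 : ℝ) ^ ((γ - q) / (γ - 2)) / (q * γ ^ ((2 - q) / (γ - 2))) * LamE q α γ a b c t := by
  have hγ0 : 0 < γ := by linarith
  have hγ2 : γ - 2 ≠ 0 := by linarith
  have hexp : (γ - q) / (γ - 2) = (2 - q) / (γ - 2) + 1 := by field_simp; ring
  have hs : 0 ≤ (2 / γ) ^ (γ - 2)⁻¹ := by positivity
  have hp : ((2 / γ) ^ (γ - 2)⁻¹) ^ (2 - q) =
      2 ^ ((2 - q) / (γ - 2)) / γ ^ ((2 - q) / (γ - 2)) := by
    rw [← rpow_mul (by positivity), ← div_rpow two_pos.le hγ0.le, inv_mul_eq_div]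
  have hr : ((2 / γ) ^ (γ - 2)⁻¹) ^ (γ - q) =
      2 ^ ((2 - q) / (γ - 2)) / γ ^ ((2 - q) / (γ - 2)) * (2 / γ) := by
    rw [← rpow_mul (by positivity), ← div_rpow two_pos.le hγ0.le, inv_mul_eq_div, hexp,
      rpow_add_one (by positivity)]
  have hg := rpow_pos_of_pos hγ0 ((2 - q) / (γ - 2))
  rw [LamN, LamE, mul_rpow hs ht.le, mul_rpow hs ht.le, hp, hr, hexp, rpow_add_one two_ne_zero]
  field_simp

theorem one_lt_two_rpow_div_mul_rpow {q γ : ℝ} (hq : 0 < q) (hq2 : q < 2) (hγ : 2 < γ) :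
    1 < (2 : ℝ) ^ ((γ - q) / (γ - 2)) / (q * γ ^ ((2 - q) / (γ - 2))) := by
  have hγ0 : 0 < γ := by linarith
  have hγ2 : 0 < γ - 2 := by linarith
  have hγq : 0 < γ - q := by linarith
  have hconc := strictConcaveOn_log_Ioi.2 (Set.mem_Ioi.2 hq) (Set.mem_Ioi.2 hγ0)
    (by linarith : q ≠ γ) (div_pos hγ2 hγq) (div_pos (sub_pos.2 hq2) hγq)
    (by field_simp; ring)
  have hmid : (γ - 2) / (γ - q) * q + (2 - q) / (γ - q) * γ = 2 := by field_simp; ring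
  simp only [smul_eq_mul, hmid] at hconc
  rw [one_lt_div (by positivity), ← log_lt_log_iff (by positivity) (by positivity),
    log_mul hq.ne' (by positivity), log_rpow hγ0, log_rpow two_pos]
  calc log q + (2 - q) / (γ - 2) * log γ
      = (γ - q) / (γ - 2) * ((γ - 2) / (γ - q) * log q + (2 - q) / (γ - q) * log γ) := by
        field_simp
    _ < (γ - q) / (γ - 2) * log 2 := by gcongr

theorem sSup_eq_of_forall_le {f : ℝ → ℝ} {s : ℝ} (hs : 0 < s) (h : ∀ t > (0 : ℝ), f t ≤ f s) :
    sSup {y | ∃ t > (0 : ℝ), y = f t} = f s :=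
  IsGreatest.csSup_eq ⟨⟨s, hs, rfl⟩, by rintro _ ⟨t, ht, rfl⟩; exact h t ht⟩

/-- `Λ^e` and `Λ^n` attain finite positive global maxima on `(0,∞)`,
`sup Λ^n = κ · sup Λ^e` with `κ = 2^{(γ−q)/(γ−2)}/(q·γ^{(2−q)/(γ−2)}) > 1`, hence
`sup Λ^e < sup Λ^n`. -/
theorem sup_LamE_lt_sup_LamN (q α γ : ℝ)
    (hq : 1 < q) (hqα : q < α) (hα : α < 2) (hγ : 2 < γ) :
    ∀ a b c : ℝ, 0 < a → 0 < b → 0 < c →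
      (∃ tE > (0 : ℝ), (∀ t > (0 : ℝ), LamE q α γ a b c t ≤ LamE q α γ a b c tE) ∧
        0 < LamE q α γ a b c tE) ∧
      (∃ tN > (0 : ℝ), (∀ t > (0 : ℝ), LamN q α γ a b c t ≤ LamN q α γ a b c tN) ∧
        0 < LamN q α γ a b c tN) ∧
      sSup {y | ∃ t > (0 : ℝ), y = LamN q α γ a b c t}
        = (2 : ℝ) ^ ((γ - q) / (γ - 2)) / (q * γ ^ ((2 - q) / (γ - 2)))
          * sSup {y | ∃ t > (0 : ℝ), y = LamE q α γ a b c t} ∧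
      1 < (2 : ℝ) ^ ((γ - q) / (γ - 2)) / (q * γ ^ ((2 - q) / (γ - 2))) ∧
      sSup {y | ∃ t > (0 : ℝ), y = LamE q α γ a b c t}
        < sSup {y | ∃ t > (0 : ℝ), y = LamN q α γ a b c t} := by
  intro a b c ha hb hc
  obtain ⟨s, hs, hmax, hpos⟩ := exists_pos_forall_LamE_le hq hqα hα hγ ha hb hc
  have hκ := one_lt_two_rpow_div_mul_rpow (q := q) (γ := γ) (by linarith) (by linarith) hγ
  have hscale {t : ℝ} (ht : 0 < t) :=
    LamN_rescale (q := q) (α := α) (a := a) (b := b) (c := c) (by linarith) hγ ht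
  generalize (2 : ℝ) ^ ((γ - q) / (γ - 2)) / (q * γ ^ ((2 - q) / (γ - 2))) = κ at hκ hscale ⊢
  have hσ : 0 < (2 / γ) ^ (γ - 2)⁻¹ := by
    have : 0 < γ := by linarith
    positivity
  generalize (2 / γ) ^ (γ - 2)⁻¹ = σ at hσ hscale
  have hσs : 0 < σ * s := mul_pos hσ hs
  have hmaxN (t : ℝ) (ht : t > 0) : LamN q α γ a b c t ≤ LamN q α γ a b c (σ * s) := by
    have hdiv : 0 < t / σ := div_pos ht hσ
    have hN := hscale hdiv
    rw [mul_div_cancel₀ _ hσ.ne'] at hN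
    rw [hN, hscale hs]
    exact mul_le_mul_of_nonneg_left (hmax _ hdiv) (by linarith)
  have hposN : 0 < LamN q α γ a b c (σ * s) := by
    rw [hscale hs]
    exact mul_pos (by linarith) hpos
  rw [sSup_eq_of_forall_le hs hmax, sSup_eq_of_forall_le hσs hmaxN]
  refine ⟨⟨s, hs, hmax, hpos⟩, ⟨σ * s, hσs, hmaxN, hposN⟩, hscale hs, hκ, ?_⟩
  rw [hscale hs]
  exact lt_mul_of_one_lt_left hpos hκ

end
end
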